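/- arXiv:q-alg/9607008 — 2 statements merged into one kernel-verified Lean document; each statement's English description precedes it below -/
import Mathlib

section
/- If there exists a surjective R-linear map from M onto N, then ℓ(i) ≤ n(i) for every index i ∈ ι. -/
open DirectSum

/-- A linear map between finite powers of non-isomorphic simple modules is zero. -/
theorem LinearMap.pi_eq_zero_of_isEmpty_linearEquiv {R A B α β : Type*} [Ring R]
    [AddCommGroup A] [Module R A] [AddCommGroup B] [Module R B]
    [IsSimpleModule R A] [IsSimpleModule R B] [Finite α]
    (h : IsEmpty (A ≃ₗ[R] B)) (g : (α → A) →ₗ[R] (β → B)) : g = 0 := by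
  classical
  refine LinearMap.pi_ext' fun a => LinearMap.ext fun x => funext fun b => ?_
  rcases (LinearMap.proj b ∘ₗ g ∘ₗ LinearMap.single R (fun _ => A) a).bijective_or_eq_zero
    with hb | hz
  · exact h.elim (LinearEquiv.ofBijective _ hb)
  · exact LinearMap.congr_fun hz x

/-- Let `R` be a ring and `(S i)_{i ∈ ι}` a family of pairwise non-isomorphic
simple `R`-modules.  Let `M = ⨁_i (S i)^{⊕ n i}` and `N = ⨁_i (S i)^{⊕ ℓ i}`.  If there is a
surjective `R`-linear map from `M` onto `N`, then `ℓ i ≤ n i` for every `i`. -/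
theorem multiplicity_le_of_surjective
    {R : Type*} [Ring R] {ι : Type*} (S : ι → Type*)
    [∀ i, AddCommGroup (S i)] [∀ i, Module R (S i)]
    (hsimple : ∀ i, IsSimpleModule R (S i))
    (hpairwise : ∀ i j, i ≠ j → IsEmpty (S i ≃ₗ[R] S j))
    (n ℓ : ι → ℕ)
    (f : (⨁ i, (Fin (n i) → S i)) →ₗ[R] ⨁ i, (Fin (ℓ i) → S i))
    (hf : Function.Surjective f) :
    ∀ i, ℓ i ≤ n i := by
  classical
  intro i
  let g := DirectSum.component R ι (fun i => Fin (ℓ i) → S i) i ∘ₗ f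
  let incl := DirectSum.lof R ι (fun i => Fin (n i) → S i) i
  have hg : g = (g ∘ₗ incl) ∘ₗ DirectSum.component R ι (fun i => Fin (n i) → S i) i := by
    refine DirectSum.linearMap_ext R fun j => ?_
    obtain rfl | hij := eq_or_ne j i
    · refine LinearMap.ext fun x => ?_
      simp [incl, DirectSum.component.lof_self]
    · have := hsimple i
      have := hsimple j
      rw [LinearMap.pi_eq_zero_of_isEmpty_linearEquiv (hpairwise j i hij) (g ∘ₗ _),
        LinearMap.comp_assoc]
      refine LinearMap.ext fun x => ?_
      simp [DirectSum.component.of, hij]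
  have hsurj : Function.Surjective (g ∘ₗ incl) := by
    intro y
    obtain ⟨x, hx⟩ := hf (DirectSum.lof R ι (fun i => Fin (ℓ i) → S i) i y)
    refine ⟨DirectSum.component R ι (fun i => Fin (n i) → S i) i x, ?_⟩
    rw [← LinearMap.comp_apply, ← hg, LinearMap.comp_apply, hx, DirectSum.component.lof_self]
  have := hsimple i
  simpa [Module.length_pi] using Module.length_le_of_surjective _ hsurj
end

section
/- Let K be a commutative ring, A an associative unital K-algebra, and h ∈ A a central element that is regular (h·a = 0 implies a = 0) such that the quotient algebra A/hA is commutative. Then: (i) for all a, b ∈ A there is a unique c ∈ A with h·c = a·b − b·a, and the bracket {a + hA, b + hA} := c + hA is independent of the choice of representatives a, b; (ii) this bracket is K-bilinear, antisymmetric, satisfies the Leibniz rule {x, y·z} = {x, y}·z + y·{x, z}, and the Jacobi identity, making A/hA a Poisson algebra. -/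
/-- Let `K` be a commutative ring, `A` an associative unital `K`-algebra, and
`h ∈ A` a central regular element such that `A/hA` is commutative (every commutator lies in
`h·A`).  Writing `Br a b c` for "`c` represents the bracket `{a + hA, b + hA}`", i.e.
`h·c = a·b − b·a`, we have:
(i) for all `a, b` there is a unique `c` with `h·c = a·b − b·a`, and the coset `c + hA` is
independent of the choice of representatives `a, b`;
(ii) the induced bracket on `A/hA` is `K`-bilinear, antisymmetric, satisfies the Leibniz rule
`{x, y·z} = {x, y}·z + y·{x, z}` and the Jacobi identity — making `A/hA` a Poisson algebra. -/
theorem quotient_by_central_regular_is_poisson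
    {K : Type*} [CommRing K] {A : Type*} [Ring A] [Algebra K A]
    (h : A)
    (hcentral : ∀ a : A, h * a = a * h)
    (hreg : ∀ a : A, h * a = 0 → a = 0)
    (hquotcomm : ∀ a b : A, ∃ c : A, a * b - b * a = h * c)
    (Br : A → A → A → Prop)
    (hBr : ∀ a b c : A, Br a b c ↔ h * c = a * b - b * a) :
    -- (i) existence and uniqueness of the bracket representative
    (∀ a b : A, ∃! c : A, h * c = a * b - b * a) ∧
    -- (i) well-definedness: independence of the choice of representatives
    (∀ a a' b b' c c' : A, (∃ u, a' - a = h * u) → (∃ v, b' - b = h * v) →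
      Br a b c → Br a' b' c' → ∃ w, c' - c = h * w) ∧
    -- (ii) additivity in the first argument
    (∀ a₁ a₂ b c₁ c₂ c₃ : A, Br a₁ b c₁ → Br a₂ b c₂ → Br (a₁ + a₂) b c₃ →
      ∃ w, c₃ - (c₁ + c₂) = h * w) ∧
    -- (ii) K-homogeneity in the first argument
    (∀ (k : K) (a b c c' : A), Br a b c → Br (k • a) b c' → ∃ w, c' - k • c = h * w) ∧
    -- (ii) additivity in the second argument
    (∀ a b₁ b₂ c₁ c₂ c₃ : A, Br a b₁ c₁ → Br a b₂ c₂ → Br a (b₁ + b₂) c₃ →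
      ∃ w, c₃ - (c₁ + c₂) = h * w) ∧
    -- (ii) K-homogeneity in the second argument
    (∀ (k : K) (a b c c' : A), Br a b c → Br a (k • b) c' → ∃ w, c' - k • c = h * w) ∧
    -- (ii) antisymmetry
    (∀ a b c c' : A, Br a b c → Br b a c' → ∃ w, c' + c = h * w) ∧
    -- (ii) Leibniz rule {x, y·z} = {x, y}·z + y·{x, z}
    (∀ x y z c₁ c₂ c₃ : A, Br x y c₁ → Br x z c₂ → Br x (y * z) c₃ →
      ∃ w, c₃ - (c₁ * z + y * c₂) = h * w) ∧
    -- (ii) Jacobi identity {x,{y,z}} + {y,{z,x}} + {z,{x,y}} = 0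
    (∀ x y z cyz czx cxy d₁ d₂ d₃ : A, Br y z cyz → Br z x czx → Br x y cxy →
      Br x cyz d₁ → Br y czx d₂ → Br z cxy d₃ → ∃ w, d₁ + d₂ + d₃ = h * w) := by
  have cancel : ∀ {x y : A}, h * x = h * y → x = y := fun {x y} hxy =>
    sub_eq_zero.mp (hreg _ (by rw [mul_sub, hxy, sub_self]))
  have left_comm : ∀ x y : A, h * (x * y) = x * (h * y) := fun x y => by
    rw [← mul_assoc, hcentral, mul_assoc]
  have of_eq : ∀ {x y : A}, x = y → ∃ w, x - y = h * w := fun hxy =>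
    ⟨0, by rw [hxy, sub_self, mul_zero]⟩
  simp only [hBr]
  refine ⟨fun a b => ?_, ?_, ?_, ?_, ?_, ?_, ?_, ?_, ?_⟩
  · obtain ⟨c, hc⟩ := hquotcomm a b
    exact ⟨c, hc.symm, fun d hd => cancel (hd.trans hc)⟩
  · rintro a a' b b' c c' ⟨u, hu⟩ ⟨v, hv⟩ hc hc'
    obtain ⟨p, hp⟩ := hquotcomm a v
    obtain ⟨q, hq⟩ := hquotcomm u b
    refine ⟨p + q + (u * v - v * u), cancel ?_⟩
    rw [sub_eq_iff_eq_add] at hu hv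
    rw [mul_sub, hc, hc', mul_add h (p + q), mul_add h p, ← hp, ← hq, hu, hv]
    simp only [mul_add, add_mul, mul_sub, mul_assoc, left_comm a, left_comm b,
      left_comm u, left_comm v]
    abel
  · intro a₁ a₂ b c₁ c₂ c₃ h₁ h₂ h₃
    refine of_eq (cancel ?_)
    rw [mul_add, h₁, h₂, h₃]
    noncomm_ring
  · intro k a b c c' hc hc'
    refine of_eq (cancel ?_)
    rw [mul_smul_comm, hc, hc', smul_mul_assoc, mul_smul_comm, smul_sub]
  · intro a b₁ b₂ c₁ c₂ c₃ h₁ h₂ h₃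
    refine of_eq (cancel ?_)
    rw [mul_add, h₁, h₂, h₃]
    noncomm_ring
  · intro k a b c c' hc hc'
    refine of_eq (cancel ?_)
    rw [mul_smul_comm, hc, hc', smul_mul_assoc, mul_smul_comm, smul_sub]
  · intro a b c c' hc hc'
    refine ⟨0, cancel ?_⟩
    rw [mul_add, hc, hc', mul_zero, mul_zero]
    abel
  · intro x y z c₁ c₂ c₃ h₁ h₂ h₃
    refine of_eq (cancel ?_)
    rw [mul_add, ← mul_assoc, left_comm, h₁, h₂, h₃]
    noncomm_ring
  · intro x y z cyz czx cxy d₁ d₂ d₃ hyz hzx hxy h₁ h₂ h₃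
    refine ⟨0, cancel (cancel ?_)⟩
    rw [mul_add h, mul_add h d₁, h₁, h₂, h₃]
    simp only [mul_add, mul_sub, mul_zero, left_comm x cyz, left_comm y czx, left_comm z cxy,
      ← mul_assoc h cyz, ← mul_assoc h czx, ← mul_assoc h cxy, hyz, hzx, hxy]
    noncomm_ring
end
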